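/- (DTM bound along geodesics.) Let μ be a probability measure on ℝ^d, F ⊂ ℝ^d a closed nonempty set, x, y ∈ ℝ^d, and let γ ∈ Γ_F(x,y) be a geodesic, i.e. D_μ(γ) = D_{μ,F}(x,y). Then sup_{t ∈ [0,1]} d_μ(γ(t)) ≤ max(d_μ(x), d_μ(y)) + ‖x − y‖. -/

import Mathlib

open MeasureTheory Metric Set ProbabilityTheory
open scoped ENNReal NNReal

noncomputable section

/-- Euclidean space `ℝ^d`. -/
abbrev Euc (d : ℕ) := EuclideanSpace ℝ (Fin d)

/-- The pseudo-distance-to-measure `δ_{μ,u}(x) = inf {r > 0 : μ(B(x,r)) > u}`. -/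
def pseudoDTM {d : ℕ} (μ : Measure (Euc d)) (u : ℝ) (x : Euc d) : ℝ :=
  sInf {r : ℝ | 0 < r ∧ u < (μ (ball x r)).toReal}

/-- The distance-to-measure `d_μ(x) = ((1/m) ∫₀^m δ_{μ,u}(x)^p du)^{1/p}`. -/
def dtm {d : ℕ} (m p : ℝ) (μ : Measure (Euc d)) (x : Euc d) : ℝ :=
  ((1 / m) * ∫ u in Ioc (0 : ℝ) m, pseudoDTM μ u x ^ p) ^ (1 / p)

/-- A Lipschitz path. -/
def IsLipschitzPath {d : ℕ} (γ : ℝ → Euc d) : Prop := ∃ K, LipschitzWith K γ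

/-- Euclidean length `|γ| = ∫₀¹ ‖γ'(t)‖ dt`. -/
def eucLength {d : ℕ} (γ : ℝ → Euc d) : ℝ := ∫ t in Icc (0 : ℝ) 1, ‖deriv γ t‖

/-- FDTM length `D_μ(γ) = ∫₀¹ d_μ(γ(t))^β ‖γ'(t)‖ dt`. -/
def fdtmLength {d : ℕ} (m p β : ℝ) (μ : Measure (Euc d)) (γ : ℝ → Euc d) : ℝ :=
  ∫ t in Icc (0 : ℝ) 1, dtm m p μ (γ t) ^ β * ‖deriv γ t‖

/-- Admissible paths `Γ_F(x,y)`: Lipschitz paths from `x` to `y` which may leave the domain `F`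
only along straight lines. -/
def AdmissiblePath {d : ℕ} (F : Set (Euc d)) (x y : Euc d) (γ : ℝ → Euc d) : Prop :=
  IsLipschitzPath γ ∧ γ 0 = x ∧ γ 1 = y ∧
    ∀ a b : ℝ, 0 ≤ a → b ≤ 1 →
      (∀ t ∈ Ioo a b, γ t ∉ F) →
      ∃ u : Euc d, ‖u‖ = 1 ∧
        ∀ᵐ t ∂(volume.restrict (Ioo a b)), deriv γ t = ‖deriv γ t‖ • u

/-- The Fermat distance-to-measure `D_{μ,F}(x,y) = inf_{γ ∈ Γ_F(x,y)} D_μ(γ)`. -/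
def fdtm {d : ℕ} (m p β : ℝ) (μ : Measure (Euc d)) (F : Set (Euc d)) (x y : Euc d) : ℝ :=
  sInf {L : ℝ | ∃ γ : ℝ → Euc d, AdmissiblePath F x y γ ∧ L = fdtmLength m p β μ γ}

/-- A geodesic: an admissible path realizing the FDTM. -/
def IsGeodesic {d : ℕ} (m p β : ℝ) (μ : Measure (Euc d)) (F : Set (Euc d)) (x y : Euc d)
    (γ : ℝ → Euc d) : Prop :=
  AdmissiblePath F x y γ ∧ fdtmLength m p β μ γ = fdtm m p β μ F x y

/-- FDTM length of the straight segment `[x,y]`. -/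
def segFDTM {d : ℕ} (m p β : ℝ) (μ : Measure (Euc d)) (x y : Euc d) : ℝ :=
  ‖x - y‖ * ∫ t in Icc (0 : ℝ) 1, dtm m p μ ((1 - t) • x + t • y) ^ β

/-- The explicit constant `λ = 2·c·ρ^{β+1}/(ρ−1)` with `c = (16·5^β + 1152·165^β)/m^{2+β}`
and `ρ = 1 + 32/m`. -/
def fdtmConst (m β : ℝ) : ℝ :=
  2 * ((16 * (5 : ℝ) ^ β + 1152 * (165 : ℝ) ^ β) / m ^ (2 + β)) * (1 + 32 / m) ^ (β + 1) /
    ((1 + 32 / m) - 1)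

/-- Support of a measure: points all of whose neighborhoods have positive mass. -/
def measSupport {d : ℕ} (μ : Measure (Euc d)) : Set (Euc d) :=
  {x | ∀ r : ℝ, 0 < r → 0 < μ (ball x r)}

/-- `(a,b)`-standard measure: `μ(B(x,r)) ≥ a·r^b` for `x ∈ supp(μ)` and `0 < r ≤ a^{-1/b}`. -/
def IsStandard {d : ℕ} (μ : Measure (Euc d)) (a b : ℝ) : Prop :=
  ∀ x ∈ measSupport μ, ∀ r : ℝ, 0 < r → r ≤ a ^ (-(1 / b)) → a * r ^ b ≤ (μ (ball x r)).toReal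

lemma exists_lt_measure_ball {d : ℕ} (μ : Measure (Euc d)) [IsProbabilityMeasure μ] {u : ℝ}
    (hu : u < 1) (x : Euc d) : {r : ℝ | 0 < r ∧ u < (μ (ball x r)).toReal}.Nonempty := by
  have h : Filter.Tendsto (fun n : ℕ => μ (ball x n)) Filter.atTop (nhds (μ (⋃ n : ℕ, ball x n))) :=
    tendsto_measure_iUnion_atTop fun a b hab => ball_subset_ball (by exact_mod_cast hab)
  rw [iUnion_ball_nat, measure_univ] at h
  have h' := (ENNReal.tendsto_toReal ENNReal.one_ne_top).comp h
  obtain ⟨n, hn, hn0⟩ :=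
    ((h'.eventually (lt_mem_nhds (by simpa using hu))).and (Filter.eventually_gt_atTop 0)).exists
  exact ⟨n, by exact_mod_cast hn0, hn⟩

lemma bddBelow_lt_measure_ball {d : ℕ} (μ : Measure (Euc d)) (u : ℝ) (x : Euc d) :
    BddBelow {r : ℝ | 0 < r ∧ u < (μ (ball x r)).toReal} :=
  ⟨0, fun _ hr => hr.1.le⟩

lemma pseudoDTM_nonneg {d : ℕ} (μ : Measure (Euc d)) (u : ℝ) (x : Euc d) :
    0 ≤ pseudoDTM μ u x :=
  Real.sInf_nonneg fun _ hr => hr.1.le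

lemma pseudoDTM_mono {d : ℕ} (μ : Measure (Euc d)) [IsProbabilityMeasure μ] {u v : ℝ}
    (huv : u ≤ v) (hv : v < 1) (x : Euc d) : pseudoDTM μ u x ≤ pseudoDTM μ v x :=
  csInf_le_csInf (bddBelow_lt_measure_ball μ u x) (exists_lt_measure_ball μ hv x)
    fun _ hr => ⟨hr.1, huv.trans_lt hr.2⟩

lemma pseudoDTM_le_add_dist {d : ℕ} (μ : Measure (Euc d)) [IsProbabilityMeasure μ] {u : ℝ}
    (hu : u < 1) (x y : Euc d) : pseudoDTM μ u x ≤ pseudoDTM μ u y + dist x y := by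
  rw [← sub_le_iff_le_add]
  refine le_csInf (exists_lt_measure_ball μ hu y) fun r hr => ?_
  rw [sub_le_iff_le_add]
  refine csInf_le (bddBelow_lt_measure_ball μ u x) ⟨add_pos_of_pos_of_nonneg hr.1 dist_nonneg, ?_⟩
  refine hr.2.trans_le (ENNReal.toReal_mono (measure_ne_top _ _) (measure_mono ?_))
  exact ball_subset_ball' (by rw [dist_comm y x])

/-- The uniform probability measure on `(0, m]`. -/
def uniformIoc (m : ℝ) : Measure ℝ := ENNReal.ofReal (1 / m) • volume.restrict (Ioc 0 m)

lemma isProbabilityMeasure_uniformIoc {m : ℝ} (hm : 0 < m) :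
    IsProbabilityMeasure (uniformIoc m) := by
  constructor
  simp only [uniformIoc, Measure.smul_apply, Measure.restrict_apply_univ, Real.volume_Ioc,
    smul_eq_mul, sub_zero]
  rw [← ENNReal.ofReal_mul (by positivity), one_div_mul_cancel hm.ne', ENNReal.ofReal_one]

lemma ae_uniformIoc {m : ℝ} {P : ℝ → Prop} (h : ∀ u ∈ Ioc 0 m, P u) :
    ∀ᵐ u ∂uniformIoc m, P u :=
  Measure.ae_smul_measure ((ae_restrict_iff' measurableSet_Ioc).2 (Filter.Eventually.of_forall h)) _

lemma memLp_pseudoDTM {d : ℕ} {m : ℝ} (hm : m ∈ Ioo (0 : ℝ) 1) (μ : Measure (Euc d))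
    [IsProbabilityMeasure μ] (x : Euc d) (q : ℝ≥0∞) :
    MemLp (fun u => pseudoDTM μ u x) q (uniformIoc m) := by
  have := isProbabilityMeasure_uniformIoc hm.1
  refine MemLp.of_bound (C := pseudoDTM μ m x) ?_ ?_
  · have h : AEMeasurable (fun u => pseudoDTM μ u x) (volume.restrict (Ioc 0 m)) :=
      aemeasurable_restrict_of_monotoneOn measurableSet_Ioc
        fun u _ v hv huv => pseudoDTM_mono μ huv (hv.2.trans_lt hm.2) x
    exact (h.smul_measure _).aestronglyMeasurable
  · refine ae_uniformIoc fun u hu => ?_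
    rw [Real.norm_of_nonneg (pseudoDTM_nonneg μ u x)]
    exact pseudoDTM_mono μ hu.2 hm.2 x

lemma dtm_eq_eLpNorm {d : ℕ} {m p : ℝ} (hm : m ∈ Ioo (0 : ℝ) 1) (hp : 1 ≤ p)
    (μ : Measure (Euc d)) [IsProbabilityMeasure μ] (x : Euc d) :
    dtm m p μ x = (eLpNorm (fun u => pseudoDTM μ u x) (ENNReal.ofReal p) (uniformIoc m)).toReal := by
  have hp0 : 0 < p := by linarith
  have hm0 := hm.1
  rw [(memLp_pseudoDTM hm μ x _).eLpNorm_eq_integral_rpow_norm (by simpa using hp0) (by simp),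
    ENNReal.toReal_ofReal (by positivity), ENNReal.toReal_ofReal hp0.le, dtm, one_div p, uniformIoc,
    integral_smul_measure, ENNReal.toReal_ofReal (by positivity)]
  simp only [Real.norm_of_nonneg (pseudoDTM_nonneg μ _ x), smul_eq_mul]

lemma dtm_nonneg {d : ℕ} {m p : ℝ} (hm : 0 ≤ m) (μ : Measure (Euc d)) (x : Euc d) :
    0 ≤ dtm m p μ x := by
  refine Real.rpow_nonneg (mul_nonneg (by positivity) (integral_nonneg fun u => ?_)) _
  exact Real.rpow_nonneg (pseudoDTM_nonneg μ u x) _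

lemma toReal_eLpNorm_le_add_const {α : Type*} [MeasurableSpace α] {ν : Measure α}
    [IsProbabilityMeasure ν] {f g : α → ℝ} {q : ℝ≥0∞} (hq : 1 ≤ q) (hg : MemLp g q ν) {a : ℝ}
    (ha : 0 ≤ a) (h : ∀ᵐ u ∂ν, ‖f u‖ ≤ g u + a) :
    (eLpNorm f q ν).toReal ≤ (eLpNorm g q ν).toReal + a := by
  have hc : MemLp (fun _ : α => a) q ν := memLp_const a
  have hcn : (eLpNorm (fun _ : α => a) q ν).toReal = a := by
    rw [eLpNorm_const _ (zero_lt_one.trans_le hq).ne' (IsProbabilityMeasure.ne_zero ν),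
      measure_univ, ENNReal.one_rpow, mul_one, toReal_enorm, Real.norm_of_nonneg ha]
  have hfg : eLpNorm f q ν ≤ eLpNorm (g + fun _ : α => a) q ν :=
    eLpNorm_mono_ae_real h
  have hle := hfg.trans (eLpNorm_add_le hg.1 hc.1 hq)
  calc (eLpNorm f q ν).toReal
      ≤ (eLpNorm g q ν + eLpNorm (fun _ : α => a) q ν).toReal :=
        ENNReal.toReal_mono (ENNReal.add_ne_top.2 ⟨hg.eLpNorm_ne_top, hc.eLpNorm_ne_top⟩) hle
    _ = (eLpNorm g q ν).toReal + a := by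
      rw [ENNReal.toReal_add hg.eLpNorm_ne_top hc.eLpNorm_ne_top, hcn]

lemma dtm_le_add_dist {d : ℕ} {m p : ℝ} (hm : m ∈ Ioo (0 : ℝ) 1) (hp : 1 ≤ p)
    (μ : Measure (Euc d)) [IsProbabilityMeasure μ] (x y : Euc d) :
    dtm m p μ x ≤ dtm m p μ y + dist x y := by
  have := isProbabilityMeasure_uniformIoc hm.1
  rw [dtm_eq_eLpNorm hm hp, dtm_eq_eLpNorm hm hp]
  refine toReal_eLpNorm_le_add_const (by simpa using hp) (memLp_pseudoDTM hm μ y _) dist_nonneg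
    (ae_uniformIoc fun u hu => ?_)
  rw [Real.norm_of_nonneg (pseudoDTM_nonneg μ u x)]
  exact pseudoDTM_le_add_dist μ (hu.2.trans_lt hm.2) x y

lemma lipschitzWith_dtm {d : ℕ} {m p : ℝ} (hm : m ∈ Ioo (0 : ℝ) 1) (hp : 1 ≤ p)
    (μ : Measure (Euc d)) [IsProbabilityMeasure μ] : LipschitzWith 1 (dtm m p μ) :=
  LipschitzWith.of_le_add fun x y => dtm_le_add_dist hm hp μ x y

/-- A function varying less than `γ` has a smaller derivative than `γ`. -/
lemma norm_deriv_le_of_dist_le {E G : Type*} [NormedAddCommGroup E] [NormedSpace ℝ E]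
    [NormedAddCommGroup G] [NormedSpace ℝ G] {f : ℝ → G} {γ : ℝ → E} {t : ℝ}
    (h : ∀ s, dist (f s) (f t) ≤ dist (γ s) (γ t)) (hγ : DifferentiableAt ℝ γ t) :
    ‖deriv f t‖ ≤ ‖deriv γ t‖ := by
  by_cases hf : DifferentiableAt ℝ f t
  · refine le_of_tendsto_of_tendsto' (hasDerivAt_iff_tendsto_slope.1 hf.hasDerivAt).norm
      (hasDerivAt_iff_tendsto_slope.1 hγ.hasDerivAt).norm fun s => ?_
    simp only [slope, vsub_eq_sub, norm_smul]
    have := h s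
    rw [dist_eq_norm, dist_eq_norm] at this
    gcongr
  · rw [deriv_zero_of_not_differentiableAt hf, norm_zero]
    exact norm_nonneg _

lemma integrableOn_rpow_mul_norm_deriv {d : ℕ} {β : ℝ} (hβ : 0 ≤ β) {φ : Euc d → ℝ}
    (hφ : Continuous φ) {γ : ℝ → Euc d} {K : ℝ≥0} (hγ : LipschitzWith K γ) :
    IntegrableOn (fun t => φ (γ t) ^ β * ‖deriv γ t‖) (Icc 0 1) := by
  have hc : Continuous fun t => φ (γ t) ^ β :=
    (hφ.comp hγ.continuous).rpow_const fun _ => Or.inr hβ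
  refine (hc.continuousOn.integrableOn_compact isCompact_Icc).mul_bdd (c := K) ?_ ?_
  · exact (measurable_deriv γ).norm.aestronglyMeasurable
  · exact Filter.Eventually.of_forall fun t => by
      simpa using norm_deriv_le_of_lipschitz hγ

/-- A path which starts and ends in the sublevel set `{φ ≤ c}` has to climb from `c` up to its
highest value and down again. -/
lemma two_mul_rpow_mul_sub_le_integral {d : ℕ} {β c : ℝ} (hβ : 0 ≤ β) (hc : 0 ≤ c)
    {φ : Euc d → ℝ} (hφ : LipschitzWith 1 φ) (hφ0 : ∀ z, 0 ≤ φ z)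
    {γ : ℝ → Euc d} {K : ℝ≥0} (hγ : LipschitzWith K γ) (h0 : φ (γ 0) ≤ c) (h1 : φ (γ 1) ≤ c)
    {t₀ : ℝ} (ht₀ : t₀ ∈ Icc (0 : ℝ) 1) :
    2 * (c ^ β * (φ (γ t₀) - c)) ≤ ∫ t in Icc (0 : ℝ) 1, φ (γ t) ^ β * ‖deriv γ t‖ := by
  set g : ℝ → ℝ := fun t => max (φ (γ t)) c with hg
  have hgL : LipschitzWith K g := by
    simpa using (hφ.comp hγ).max_const c
  have hdist : ∀ s t, dist (g s) (g t) ≤ dist (γ s) (γ t) := fun s t => by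
    simpa using (hφ.max_const c).dist_le_mul (γ s) (γ t)
  have hac : ∀ a b, AbsolutelyContinuousOnInterval g a b := fun a b =>
    (hgL.lipschitzOnWith (s := uIcc a b)).absolutelyContinuousOnInterval
  have hi : ∀ a b, IntervalIntegrable (fun t => ‖deriv g t‖) volume a b := fun a b =>
    (hac a b).intervalIntegrable_deriv.norm
  have hint : 2 * (φ (γ t₀) - c) ≤ ∫ t in Icc (0 : ℝ) 1, ‖deriv g t‖ := by
    rw [integral_Icc_eq_integral_Ioc, ← intervalIntegral.integral_of_le zero_le_one,
      ← intervalIntegral.integral_add_adjacent_intervals (hi 0 t₀) (hi t₀ 1)]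
    have e1 := intervalIntegral.norm_integral_le_integral_norm (f := deriv g) (μ := volume) ht₀.1
    have e2 := intervalIntegral.norm_integral_le_integral_norm (f := deriv g) (μ := volume) ht₀.2
    rw [(hac _ _).integral_deriv_eq_sub, Real.norm_eq_abs] at e1 e2
    have hg0 : g 0 = c := max_eq_right h0
    have hg1 : g 1 = c := max_eq_right h1
    have hgt : φ (γ t₀) ≤ g t₀ := le_max_left _ _
    rw [hg0] at e1
    rw [hg1] at e2
    linarith [le_abs_self (g t₀ - c), neg_le_abs (c - g t₀)]
  calc 2 * (c ^ β * (φ (γ t₀) - c)) = c ^ β * (2 * (φ (γ t₀) - c)) := by ring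
    _ ≤ c ^ β * ∫ t in Icc (0 : ℝ) 1, ‖deriv g t‖ := by gcongr
    _ = ∫ t in Icc (0 : ℝ) 1, c ^ β * ‖deriv g t‖ := (integral_const_mul _ _).symm
    _ ≤ _ := by
      refine integral_mono_ae ?_ (integrableOn_rpow_mul_norm_deriv hβ hφ.continuous hγ) ?_
      · refine Integrable.const_mul ?_ _
        have := (intervalIntegrable_iff_integrableOn_Ioc_of_le zero_le_one).1 (hi 0 1)
        exact (integrableOn_Icc_iff_integrableOn_Ioc).2 this
      · refine ae_restrict_of_ae ?_
        filter_upwards [hγ.ae_differentiableAt_real] with t ht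
        rcases lt_or_ge (φ (γ t)) c with hlt | hge
        · have hev : g =ᶠ[nhds t] fun _ => c := by
            filter_upwards [(hφ.continuous.comp hγ.continuous).continuousAt.eventually
              (gt_mem_nhds hlt)] with s hs
            exact max_eq_right (le_of_lt hs)
          have := hφ0 (γ t)
          simp only [hev.deriv_eq, deriv_const, norm_zero, mul_zero]
          positivity
        · have hle := norm_deriv_le_of_dist_le (fun s => hdist s t) ht
          have := hφ0 (γ t)
          gcongr

lemma fdtmLength_nonneg {d : ℕ} {m p β : ℝ} (hm : 0 ≤ m) (μ : Measure (Euc d)) (γ : ℝ → Euc d) :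
    0 ≤ fdtmLength m p β μ γ :=
  integral_nonneg fun _ => mul_nonneg (Real.rpow_nonneg (dtm_nonneg hm μ _) _) (norm_nonneg _)

/-- The FDTM is at most the length of the straight segment. -/
lemma fdtm_le_of_forall_segment {d : ℕ} {m p β C : ℝ} (hm : 0 ≤ m) (hβ : 0 ≤ β)
    (μ : Measure (Euc d)) (F : Set (Euc d)) (x y : Euc d) (hd : ∃ u : Euc d, ‖u‖ = 1)
    (hC : ∀ t ∈ Icc (0 : ℝ) 1, dtm m p μ (x + t • (y - x)) ≤ C) :
    fdtm m p β μ F x y ≤ C ^ β * ‖x - y‖ := by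
  set σ : ℝ → Euc d := fun t => x + t • (y - x) with hσ
  have hder : ∀ t, deriv σ t = y - x := fun t => by
    have h := ((hasDerivAt_id' t).smul_const (y - x)).const_add x
    rw [one_smul] at h
    exact h.deriv
  have hadm : AdmissiblePath F x y σ := by
    refine ⟨⟨‖y - x‖₊, LipschitzWith.of_dist_le_mul fun s t => ?_⟩, by simp [hσ], by simp [hσ],
      fun a b _ _ _ => ?_⟩
    · simp only [hσ, dist_eq_norm, add_sub_add_left_eq_sub, ← sub_smul, norm_smul, coe_nnnorm]
      exact (mul_comm _ _).le
    · simp only [hder]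
      rcases eq_or_ne (y - x) 0 with h | h
      · obtain ⟨u, hu⟩ := hd
        exact ⟨u, hu, by simp [h]⟩
      · exact ⟨‖y - x‖⁻¹ • (y - x), norm_smul_inv_norm h, by
          simp [smul_smul, mul_inv_cancel₀ (norm_ne_zero_iff.2 h)]⟩
  have hle : fdtm m p β μ F x y ≤ fdtmLength m p β μ σ :=
    csInf_le ⟨0, by rintro _ ⟨γ, -, rfl⟩; exact fdtmLength_nonneg hm μ γ⟩ ⟨σ, hadm, rfl⟩
  refine hle.trans ?_
  have hb := norm_setIntegral_le_of_norm_le_const (μ := volume) (s := Icc (0 : ℝ) 1)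
    (f := fun t => dtm m p μ (σ t) ^ β * ‖deriv σ t‖) (C := C ^ β * ‖x - y‖) (by simp)
    fun t ht => by
      have h0 := dtm_nonneg (p := p) hm μ (σ t)
      rw [Real.norm_of_nonneg (by positivity), hder, norm_sub_rev y x]
      have := hC t ht
      gcongr
  exact (le_abs_self _).trans (by simpa [fdtmLength] using hb)

lemma dtm_segment_le {d : ℕ} {m p : ℝ} (hm : m ∈ Ioo (0 : ℝ) 1) (hp : 1 ≤ p)
    (μ : Measure (Euc d)) [IsProbabilityMeasure μ] (x y : Euc d) {t : ℝ}
    (ht : t ∈ Icc (0 : ℝ) 1) :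
    dtm m p μ (x + t • (y - x)) ≤ max (dtm m p μ x) (dtm m p μ y) + ‖x - y‖ / 2 := by
  have hn := norm_nonneg (x - y)
  rcases le_total t (1 / 2) with h | h
  · have h1 := dtm_le_add_dist hm hp μ (x + t • (y - x)) x
    have h2 : dist (x + t • (y - x)) x = t * ‖x - y‖ := by
      rw [dist_eq_norm, add_sub_cancel_left, norm_smul, Real.norm_of_nonneg ht.1, norm_sub_rev]
    nlinarith [le_max_left (dtm m p μ x) (dtm m p μ y)]
  · have h1 := dtm_le_add_dist hm hp μ (x + t • (y - x)) y
    have h2 : dist (x + t • (y - x)) y = (1 - t) * ‖x - y‖ := by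
      rw [dist_eq_norm, show x + t • (y - x) - y = (1 - t) • (x - y) by module, norm_smul,
        Real.norm_of_nonneg (by linarith [ht.2])]
    nlinarith [le_max_right (dtm m p μ x) (dtm m p μ y)]

lemma dtm_le_of_isGeodesic {d : ℕ} {m p β : ℝ} (hm : m ∈ Ioo (0 : ℝ) 1) (hp : 1 ≤ p)
    (hβ : 0 < β) (μ : Measure (Euc d)) [IsProbabilityMeasure μ] {F : Set (Euc d)} {x y : Euc d}
    {γ : ℝ → Euc d} (hγ : IsGeodesic m p β μ F x y γ) {t : ℝ} (ht : t ∈ Icc (0 : ℝ) 1) :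
    dtm m p μ (γ t) ≤ max (dtm m p μ x) (dtm m p μ y) + ‖x - y‖ := by
  obtain ⟨⟨⟨K, hK⟩, h0, h1, hF⟩, hlen⟩ := hγ
  have hd : ∃ u : Euc d, ‖u‖ = 1 := by
    obtain ⟨u, hu, -⟩ := hF 1 0 zero_le_one zero_le_one (by simp)
    exact ⟨u, hu⟩
  have hup := fdtm_le_of_forall_segment (β := β) hm.1.le hβ.le μ F x y hd
    fun t ht => dtm_segment_le hm hp μ x y ht
  rw [← hlen] at hup
  set D := max (dtm m p μ x) (dtm m p μ y) with hD
  have hD0 : 0 ≤ D := (dtm_nonneg hm.1.le μ x).trans (le_max_left _ _)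
  have hL := norm_nonneg (x - y)
  have hlow : ∀ c, D ≤ c → 2 * (c ^ β * (dtm m p μ (γ t) - c)) ≤ fdtmLength m p β μ γ :=
    fun c hc => two_mul_rpow_mul_sub_le_integral hβ.le (hD0.trans hc) (lipschitzWith_dtm hm hp μ)
      (dtm_nonneg hm.1.le μ) hK (by rw [h0]; exact (le_max_left _ _).trans hc)
      (by rw [h1]; exact (le_max_right _ _).trans hc) ht
  by_contra! hlt
  rcases (show 0 ≤ D + ‖x - y‖ / 2 by positivity).eq_or_lt with hz | hpos
  · have hDz : D = 0 := by linarith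
    have hLz : ‖x - y‖ = 0 := by linarith
    have hM : 0 < dtm m p μ (γ t) := by linarith
    have := hlow (dtm m p μ (γ t) / 2) (by linarith)
    rw [hLz, mul_zero] at hup
    have : 0 < (dtm m p μ (γ t) / 2) ^ β * (dtm m p μ (γ t) - dtm m p μ (γ t) / 2) :=
      mul_pos (by positivity) (by linarith)
    linarith
  · have := hlow _ (show D ≤ D + ‖x - y‖ / 2 by linarith)
    have hpow : 0 < (D + ‖x - y‖ / 2) ^ β := by positivity
    nlinarith

theorem dtm_bound_along_geodesic {d : ℕ} (m p β : ℝ) (hm : m ∈ Set.Ioo (0 : ℝ) 1) (hp : 1 ≤ p)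
    (hβ : 1 ≤ β) (μ : Measure (Euc d)) [IsProbabilityMeasure μ]
    (F : Set (Euc d)) (hF : IsClosed F) (hFne : F.Nonempty) (x y : Euc d)
    (γ : ℝ → Euc d) (hγ : IsGeodesic m p β μ F x y γ) :
    (⨆ t ∈ Icc (0 : ℝ) 1, dtm m p μ (γ t)) ≤ max (dtm m p μ x) (dtm m p μ y) + ‖x - y‖ := by
  have hbound : 0 ≤ max (dtm m p μ x) (dtm m p μ y) + ‖x - y‖ :=
    add_nonneg ((dtm_nonneg hm.1.le μ x).trans (le_max_left _ _)) (norm_nonneg _)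
  exact Real.iSup_le (fun t => Real.iSup_le
    (fun ht => dtm_le_of_isGeodesic hm hp (by linarith) μ hγ ht) hbound) hbound

end
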